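/- Let ω = exp(2πi/3) and let r₁, r₂, r₃, r₄ ∈ ℂ⁴ be the rows of the Elegant Joint Measurement matrix U₄: r₁ = ((1/2)√(2+√3), 0, 0, −(1/2)√(2−√3)), r₂ = ((1/6)√(6−3√3), 1/√3, 1/√3, (1/6)√(6+3√3)), r₃ = ((1/6)√(6−3√3), ω²/√3, ω/√3, (1/6)√(6+3√3)), r₄ = ((1/6)√(6−3√3), ω/√3, ω²/√3, (1/6)√(6+3√3)). Identify ℂ⁴ with functions Fin 2 × Fin 2 → ℂ via (a,b) ↦ 2a+b, let ρ_i(a,b) = Σ_k r_i(a,k)·conj(r_i(b,k)) be the reduced 2×2 matrices, and set ρ̃_i = (1/2)·ρ_i. Then for every 2×2 complex matrix σ with trace(σ) = 1: σ = 8·Σ_{i=1}^{4} trace(ρ̃_i·σ)·ρ̃_i − (3/2)·I. -/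

import Mathlib

open scoped ComplexConjugate

noncomputable section

/-- The primitive third root of unity `ω = exp(2πi/3)`. -/
def ω : ℂ := Complex.exp (2 * Real.pi * Complex.I / 3)

/-- The Elegant Joint Measurement matrix `U₄`. -/
def U₄ : Matrix (Fin 4) (Fin 4) ℂ :=
  !![(((1 : ℝ) / 2) * Real.sqrt (2 + Real.sqrt 3) : ℝ), 0, 0,
      (-(((1 : ℝ) / 2) * Real.sqrt (2 - Real.sqrt 3)) : ℝ);
    ((((1 : ℝ) / 6) * Real.sqrt (6 - 3 * Real.sqrt 3) : ℝ) : ℂ),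
      (1 / (Real.sqrt 3 : ℂ)), (1 / (Real.sqrt 3 : ℂ)),
      ((((1 : ℝ) / 6) * Real.sqrt (6 + 3 * Real.sqrt 3) : ℝ) : ℂ);
    ((((1 : ℝ) / 6) * Real.sqrt (6 - 3 * Real.sqrt 3) : ℝ) : ℂ),
      (ω ^ 2 / (Real.sqrt 3 : ℂ)), (ω / (Real.sqrt 3 : ℂ)),
      ((((1 : ℝ) / 6) * Real.sqrt (6 + 3 * Real.sqrt 3) : ℝ) : ℂ);
    ((((1 : ℝ) / 6) * Real.sqrt (6 - 3 * Real.sqrt 3) : ℝ) : ℂ),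
      (ω / (Real.sqrt 3 : ℂ)), (ω ^ 2 / (Real.sqrt 3 : ℂ)),
      ((((1 : ℝ) / 6) * Real.sqrt (6 + 3 * Real.sqrt 3) : ℝ) : ℂ)]

/-- The `i`-th row of `U₄`, viewed as a two-qubit state via `(a,b) ↦ 2a+b`. -/
def ejmState (i : Fin 4) (p : Fin 2 × Fin 2) : ℂ :=
  U₄ i ⟨2 * p.1.val + p.2.val, by omega⟩

/-- The reduced density matrix (partial trace over the second qubit) of the
`i`-th EJM basis state. -/
def ejmReduced (i : Fin 4) : Matrix (Fin 2) (Fin 2) ℂ :=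
  Matrix.of fun a b => ∑ k, ejmState i (a, k) * conj (ejmState i (b, k))

/-- The single-qubit POVM elements `ρ̃_i = ρ_i/2` obtained by reduction of
the Elegant Joint Measurement. -/
def ejmPOVM (i : Fin 4) : Matrix (Fin 2) (Fin 2) ℂ :=
  (1 / 2 : ℂ) • ejmReduced i

theorem ω_pow_three : ω ^ 3 = 1 :=
  (Complex.isPrimitiveRoot_exp 3 (by norm_num)).pow_eq_one

theorem one_add_ω_add_sq : 1 + ω + ω ^ 2 = 0 := by
  have h := (Complex.isPrimitiveRoot_exp 3 (by norm_num)).geom_sum_eq_zero (by norm_num)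
  simpa [Finset.sum_range_succ, ω] using h

theorem conj_ω : conj ω = ω ^ 2 := by
  have h : conj ω * ω = 1 := by
    rw [ω, ← Complex.exp_conj, ← Complex.exp_add, ← Complex.exp_zero]
    congr 1
    simp [Complex.conj_ofNat]
    ring
  linear_combination ω ^ 2 * h - conj ω * ω_pow_three

theorem sqrt_three_le_two : √3 ≤ 2 := Real.sqrt_le_iff.mpr (by norm_num)

/-- The common modulus of the off-diagonal entries of the last three reduced states. -/
theorem ejm_offDiag_modulus :
    (1 / 6 * √(6 - 3 * √3) + 1 / 6 * √(6 + 3 * √3)) / √3 = √6 / 6 := by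
  have hle := sqrt_three_le_two
  have h3 : √3 ^ 2 = 3 := Real.sq_sqrt (by norm_num)
  have hprod : √(6 - 3 * √3) * √(6 + 3 * √3) = 3 := by
    rw [← Real.sqrt_mul (by linarith), Real.sqrt_eq_iff_mul_self_eq_of_pos (by norm_num)]
    linear_combination 9 * h3
  have hm := Real.sq_sqrt (show 0 ≤ 6 - 3 * √3 by linarith)
  have hp := Real.sq_sqrt (show 0 ≤ 6 + 3 * √3 by positivity)
  have h6 : √6 ^ 2 = 6 := Real.sq_sqrt (by norm_num)
  refine (sq_eq_sq₀ (by positivity) (by positivity)).mp ?_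
  rw [div_pow, div_pow, h3, h6]
  linear_combination (1 / 108) * hm + (1 / 108) * hp + (1 / 54) * hprod

/-- The POVM element attached to a row `(s, b / √3, c / √3, t)` of `U₄` with `c = conj b = b⁻¹`,
where `s` and `t` are the outer amplitudes of the last three rows. -/
theorem ejmPOVM_eq_of_row {i : Fin 4} {b c : ℂ}
    (hrow : U₄ i = ![((1 / 6 * √(6 - 3 * √3) : ℝ) : ℂ), b / (√3 : ℂ), c / (√3 : ℂ),
      ((1 / 6 * √(6 + 3 * √3) : ℝ) : ℂ)])
    (hb : conj b = c) (hbc : b * c = 1) :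
    ejmPOVM i = !![(6 - (√3 : ℂ)) / 24, (√6 : ℂ) / 12 * b;
      (√6 : ℂ) / 12 * c, (6 + (√3 : ℂ)) / 24] := by
  have hc : conj c = b := by rw [← hb, Complex.conj_conj]
  have hle := sqrt_three_le_two
  have hs : ((1 / 6 * √(6 - 3 * √3) : ℝ) : ℂ) ^ 2 = (2 - (√3 : ℂ)) / 12 := by
    rw [← Complex.ofReal_pow, mul_pow, Real.sq_sqrt (by linarith)]
    push_cast
    ring
  have ht : ((1 / 6 * √(6 + 3 * √3) : ℝ) : ℂ) ^ 2 = (2 + (√3 : ℂ)) / 12 := by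
    rw [← Complex.ofReal_pow, mul_pow, Real.sq_sqrt (by positivity)]
    push_cast
    ring
  have hst := congrArg Complex.ofReal ejm_offDiag_modulus
  rw [Complex.ofReal_div, Complex.ofReal_add, Complex.ofReal_div] at hst
  have h3 : ((√3 : ℂ)⁻¹) ^ 2 = 1 / 3 := by
    rw [inv_pow, ← Complex.ofReal_pow, Real.sq_sqrt (by norm_num)]
    norm_num
  generalize ((1 / 6 * √(6 - 3 * √3) : ℝ)) = s at *
  generalize ((1 / 6 * √(6 + 3 * √3) : ℝ)) = t at *
  rw [div_eq_mul_inv] at hst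
  ext x y
  fin_cases x <;> fin_cases y <;>
    simp [ejmPOVM, ejmReduced, ejmState, hrow, hb, hc, div_eq_mul_inv] at hst ⊢
  · linear_combination (1 / 2) * hs + (1 / 2) * b * c * h3 + (1 / 6) * hbc
  · linear_combination (1 / 2) * b * hst
  · linear_combination (1 / 2) * c * hst
  · linear_combination (1 / 2) * ht + (1 / 2) * b * c * h3 + (1 / 6) * hbc

theorem ejmPOVM_zero :
    ejmPOVM 0 = !![(2 + (√3 : ℂ)) / 8, 0; 0, (2 - (√3 : ℂ)) / 8] := by
  have hle := sqrt_three_le_two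
  have hp : (√(2 + √3) : ℂ) ^ 2 = 2 + (√3 : ℂ) := by
    rw [← Complex.ofReal_pow, Real.sq_sqrt (by positivity)]
    push_cast
    rfl
  have hm : (√(2 - √3) : ℂ) ^ 2 = 2 - (√3 : ℂ) := by
    rw [← Complex.ofReal_pow, Real.sq_sqrt (by linarith)]
    push_cast
    rfl
  ext x y
  fin_cases x <;> fin_cases y <;> simp [ejmPOVM, ejmReduced, ejmState, U₄, Complex.conj_ofNat]
  · linear_combination (1 / 8) * hp
  · linear_combination (1 / 8) * hm

theorem ejmPOVM_one :
    ejmPOVM 1 = !![(6 - (√3 : ℂ)) / 24, (√6 : ℂ) / 12 * 1;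
      (√6 : ℂ) / 12 * 1, (6 + (√3 : ℂ)) / 24] :=
  ejmPOVM_eq_of_row rfl (map_one _) (one_mul 1)

theorem ejmPOVM_two :
    ejmPOVM 2 = !![(6 - (√3 : ℂ)) / 24, (√6 : ℂ) / 12 * ω ^ 2;
      (√6 : ℂ) / 12 * ω, (6 + (√3 : ℂ)) / 24] :=
  ejmPOVM_eq_of_row rfl (by rw [← conj_ω, Complex.conj_conj])
    (by rw [← pow_succ, ω_pow_three])

theorem ejmPOVM_three :
    ejmPOVM 3 = !![(6 - (√3 : ℂ)) / 24, (√6 : ℂ) / 12 * ω;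
      (√6 : ℂ) / 12 * ω ^ 2, (6 + (√3 : ℂ)) / 24] :=
  ejmPOVM_eq_of_row rfl conj_ω (by rw [← pow_succ', ω_pow_three])

/-- Linear state-reconstruction (tomography) formula for the
qubit POVM obtained from the Elegant Joint Measurement:
`σ = 8·Σᵢ trace(ρ̃ᵢσ)·ρ̃ᵢ − (3/2)·I` for every `σ` with `trace σ = 1`. -/
theorem ejm_tomography (σ : Matrix (Fin 2) (Fin 2) ℂ) (hσ : Matrix.trace σ = 1) :
    σ = (8 : ℂ) • (∑ i, Matrix.trace (ejmPOVM i * σ) • ejmPOVM i) -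
      (3 / 2 : ℂ) • (1 : Matrix (Fin 2) (Fin 2) ℂ) := by
  have h3 : (√3 : ℂ) ^ 2 = 3 := by
    rw [← Complex.ofReal_pow, Real.sq_sqrt (by norm_num)]
    norm_num
  have h6 : (√6 : ℂ) ^ 2 = 6 := by
    rw [← Complex.ofReal_pow, Real.sq_sqrt (by norm_num)]
    norm_num
  have hω := one_add_ω_add_sq
  have hω3 := ω_pow_three
  rw [Matrix.trace_fin_two] at hσ
  rw [Fin.sum_univ_four, ejmPOVM_zero, ejmPOVM_one, ejmPOVM_two, ejmPOVM_three]
  generalize (√3 : ℂ) = q at *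
  generalize (√6 : ℂ) = p at *
  ext x y
  fin_cases x <;> fin_cases y <;>
    simp [Matrix.trace_fin_two, Matrix.vecMul, dotProduct] <;>
    grind

end
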